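/- Let (V', J, g') be an almost complex Norden metric vector space and N ∈ V' with g'(N,N) = -1. Set t = arctan(g'(N,JN)), ξ = sin t · N + cos t · JN, η(X) = cos t · g'(X,JN), and φX = JX + cos t · g'(X,JN)(cos t · N - sin t · JN). Then on the hyperplane M = {X : g'(X,N) = 0}, the structure (φ, ξ, η, g = g'|_M) satisfies the almost contact Norden metric conditions: φ²X = -X + η(X)ξ, η(ξ) = 1, and g(φX, φY) = -g(X,Y) + η(X)η(Y) for all X, Y ∈ M. -/

import Mathlib

open Real

/-- the real time-like hypersurface construction produces an
almost contact Norden metric structure on the hyperplane M = N^⊥. -/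
theorem stmt_13 {V' : Type*} [AddCommGroup V'] [Module ℝ V']
    (J : V' →ₗ[ℝ] V') (g' : V' →ₗ[ℝ] V' →ₗ[ℝ] ℝ)
    (hJ : ∀ X, J (J X) = -X)
    (hsym : ∀ X Y, g' X Y = g' Y X)
    (hnd : ∀ X, (∀ Y, g' X Y = 0) → X = 0)
    (hNorden : ∀ X Y, g' (J X) (J Y) = -g' X Y)
    (N : V') (hN : g' N N = -1)
    (t : ℝ) (ht : t = arctan (g' N (J N)))
    (ξ : V') (hξ : ξ = sin t • N + cos t • J N)
    (η : V' → ℝ) (hη : ∀ X, η X = cos t * g' X (J N))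
    (φ : V' → V')
    (hφ : ∀ X, φ X = J X + (cos t * g' X (J N)) • (cos t • N - sin t • J N)) :
    (∀ X, g' X N = 0 → φ (φ X) = -X + η X • ξ) ∧
    η ξ = 1 ∧
    (∀ X Y, g' X N = 0 → g' Y N = 0 →
      g' (φ X) (φ Y) = -g' X Y + η X * η Y) := by
  have hc : cos t ≠ 0 := by
    rw [ht]; exact (cos_arctan_pos _).ne'
  have hs : sin t = cos t * g' N (J N) := by
    have h : tan t = g' N (J N) := by rw [ht, tan_arctan]
    rw [← h, tan_eq_sin_div_cos]
    field_simp
  have hcs : sin t ^ 2 + cos t ^ 2 = 1 := sin_sq_add_cos_sq t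
  have hJN : g' (J N) (J N) = 1 := by rw [hNorden, hN]; norm_num
  have hmove : ∀ X, g' (J X) N = g' X (J N) := by
    intro X
    have h := hNorden X (J N)
    rw [hJ] at h
    simp only [map_neg] at h
    linarith
  refine ⟨?_, ?_, ?_⟩
  · intro X hX
    have h0 : g' (φ X) (J N) = 0 := by
      rw [hφ]
      simp only [map_add, map_sub, map_smul, LinearMap.add_apply, LinearMap.sub_apply,
        LinearMap.smul_apply, smul_eq_mul, hNorden, hN, hX]
      rw [hs]; ring
    rw [hφ (φ X), h0, hφ X, hη, hξ]
    simp only [map_add, map_sub, map_smul, hJ]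
    module
  · rw [hη, hξ]
    simp only [map_add, map_smul, LinearMap.add_apply,
        LinearMap.smul_apply, smul_eq_mul, hJN]
    linear_combination hcs - sin t * hs
  · intro X Y hX hY
    have hNJ : g' (J N) N = g' N (J N) := hsym _ _
    have hY2 : g' N (J Y) = g' Y (J N) := by rw [hsym, hmove]
    have hY3 : g' N Y = 0 := by rw [hsym, hY]
    rw [hφ X, hφ Y, hη, hη]
    simp only [map_add, map_sub, map_smul, LinearMap.add_apply, LinearMap.sub_apply,
        LinearMap.smul_apply, smul_eq_mul, hNorden, hN, hX, hmove, hY2, hY3]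
    linear_combination (cos t ^ 2 * g' X (J N) * g' Y (J N)) * (2 * sin t * hs - hcs)
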